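/- Define the total effective resistance R(s) = Σ_{1 ≤ i < j ≤ n} (e_i − e_j)ᵀ L_s^† (e_i − e_j), the sum of effective resistances over all node pairs. Fix an edge index e. For every connected s in the open set {s ∈ ℝ^m : s_e > 0 on a connected spanning edge set}, R is differentiable in the coordinate s_e with ∂R(s)/∂s_e = − n · w_e · a_eᵀ (L_s^†)² a_e. -/

import Mathlib

open Matrix MeasureTheory BigOperators

noncomputable section

/-- `A` is a signed incidence matrix: each row is `e_i - e_j` for some `i ≠ j`. -/
def isIncidence (n m : ℕ) (A : Matrix (Fin m) (Fin n) ℝ) : Prop :=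
  ∀ e : Fin m, ∃ i j : Fin n, i ≠ j ∧
    A e = fun k => (if k = i then (1 : ℝ) else 0) - (if k = j then (1 : ℝ) else 0)

/-- The matrix `1 1ᵀ / n`, with all entries equal to `1/n`. -/
def onesMat (n : ℕ) : Matrix (Fin n) (Fin n) ℝ := fun _ _ => (1 : ℝ) / n

/-- The switched Laplacian `L_s = Aᵀ diag(w ∘ s) A`. -/
def Lap (n m : ℕ) (A : Matrix (Fin m) (Fin n) ℝ) (w s : Fin m → ℝ) :
    Matrix (Fin n) (Fin n) ℝ :=
  Aᵀ * Matrix.diagonal (fun e => w e * s e) * A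

/-- The Moore–Penrose pseudoinverse of a connected Laplacian:
`L† = (L + 1 1ᵀ/n)⁻¹ - 1 1ᵀ/n`. -/
def Lpinv (n m : ℕ) (A : Matrix (Fin m) (Fin n) ℝ) (w s : Fin m → ℝ) :
    Matrix (Fin n) (Fin n) ℝ :=
  (Lap n m A w s + onesMat n)⁻¹ - onesMat n

/-- Connectivity, encoded as: the kernel of the Laplacian is exactly `span(1)`. -/
def kerIsOnes (n : ℕ) (L : Matrix (Fin n) (Fin n) ℝ) : Prop :=
  ∀ y : Fin n → ℝ, L.mulVec y = 0 ↔ ∃ c : ℝ, y = fun _ => c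

/-- The relaxed congestion `φ(s) = dᵀ L_s† d`. -/
def phi (n m : ℕ) (A : Matrix (Fin m) (Fin n) ℝ) (w s : Fin m → ℝ) (d : Fin n → ℝ) : ℝ :=
  d ⬝ᵥ (Lpinv n m A w s).mulVec d

/-- The vector `e_i - e_j` of ℝⁿ. -/
def pairVec (n : ℕ) (i j : Fin n) : Fin n → ℝ :=
  fun k => (if k = i then (1 : ℝ) else 0) - (if k = j then (1 : ℝ) else 0)

/-- Total effective resistance `R(s) = Σ_{i<j} (e_i−e_j)ᵀ L_s† (e_i−e_j)`. -/
def totalRes (n m : ℕ) (A : Matrix (Fin m) (Fin n) ℝ) (w s : Fin m → ℝ) : ℝ :=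
  ∑ i : Fin n, ∑ j : Fin n,
    if i < j then pairVec n i j ⬝ᵥ (Lpinv n m A w s).mulVec (pairVec n i j) else 0

section InverseDerivative

attribute [local instance] Matrix.linftyOpNormedRing Matrix.linftyOpNormedAlgebra

/-- Derivative of a matrix inverse along a line, tested against two vectors. -/
theorem hasDerivAt_dotProduct_inv_mulVec {ι : Type*} [Fintype ι] [DecidableEq ι]
    (M B : Matrix ι ι ℝ) (hM : IsUnit M) (t₀ : ℝ) (x y : ι → ℝ) :
    HasDerivAt (fun t : ℝ => x ⬝ᵥ (M + (t - t₀) • B)⁻¹ *ᵥ y)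
      (-(x ⬝ᵥ (M⁻¹ * B * M⁻¹) *ᵥ y)) t₀ := by
  have hline : HasDerivAt (fun t : ℝ => M + (t - t₀) • B) B t₀ := by
    exact ((((hasDerivAt_id t₀).sub_const t₀).smul_const B).const_add M).congr_deriv (one_smul ℝ B)
  obtain ⟨U, rfl⟩ := hM
  have hinv : HasFDerivAt Ring.inverse
      (-ContinuousLinearMap.mulLeftRight ℝ (Matrix ι ι ℝ) ↑U⁻¹ ↑U⁻¹)
      ((U : Matrix ι ι ℝ) + (t₀ - t₀) • B) := by
    simpa using hasFDerivAt_ringInverse (𝕜 := ℝ) U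
  have hcomp := hinv.comp_hasDerivAt t₀ hline
  let ℓ : Matrix ι ι ℝ →ₗ[ℝ] ℝ :=
    { toFun := fun X => x ⬝ᵥ X *ᵥ y
      map_add' := fun X Y => by rw [Matrix.add_mulVec, dotProduct_add]
      map_smul' := fun c X => by rw [Matrix.smul_mulVec, dotProduct_smul]; rfl }
  have h := (LinearMap.toContinuousLinearMap ℓ).hasFDerivAt.comp_hasDerivAt t₀ hcomp
  have hfun : (fun t : ℝ => x ⬝ᵥ ((U : Matrix ι ι ℝ) + (t - t₀) • B)⁻¹ *ᵥ y)
      = LinearMap.toContinuousLinearMap ℓ ∘ Ring.inverse ∘ fun t => (U : Matrix ι ι ℝ) +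
        (t - t₀) • B := by
    funext t
    simp [ℓ, Matrix.nonsing_inv_eq_ringInverse]
  rw [hfun]
  refine h.congr_deriv ?_
  change x ⬝ᵥ (-((↑U⁻¹ : Matrix ι ι ℝ) * B * (↑U⁻¹ : Matrix ι ι ℝ))) *ᵥ y = _
  rw [Matrix.neg_mulVec, dotProduct_neg, Matrix.coe_units_inv]

end InverseDerivative

theorem sum_lt_eq_half_sum {n : ℕ} (f : Fin n → Fin n → ℝ) (hsymm : ∀ i j, f i j = f j i)
    (hdiag : ∀ i, f i i = 0) :
    ∑ i, ∑ j, (if i < j then f i j else 0) = (∑ i, ∑ j, f i j) / 2 := by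
  have hswap : ∑ i, ∑ j, (if j < i then f i j else 0)
      = ∑ i, ∑ j, (if i < j then f i j else 0) := by
    rw [Finset.sum_comm]
    simp_rw [fun i j => hsymm j i]
  have hsplit : ∑ i, ∑ j, f i j
      = ∑ i, ∑ j, (if i < j then f i j else 0) + ∑ i, ∑ j, (if j < i then f i j else 0) := by
    simp_rw [← Finset.sum_add_distrib]
    refine Finset.sum_congr rfl fun i _ => Finset.sum_congr rfl fun j _ => ?_
    rcases lt_trichotomy i j with h | h | h
    · simp [h, h.not_gt]
    · simp [h, hdiag]
    · simp [h, h.not_gt]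
  rw [hsplit, hswap]
  ring

theorem sum_lt_sq_sub {n : ℕ} (u : Fin n → ℝ) (hu : ∑ i, u i = 0) :
    ∑ i, ∑ j, (if i < j then (u i - u j) ^ 2 else 0) = n * (u ⬝ᵥ u) := by
  rw [sum_lt_eq_half_sum _ (fun i j => by ring) (fun i => by ring)]
  have hexp : ∀ i j, (u i - u j) ^ 2 = u i ^ 2 - 2 * u i * u j + u j ^ 2 := fun i j => by ring
  simp_rw [hexp, Finset.sum_add_distrib, Finset.sum_sub_distrib, ← Finset.mul_sum, hu]
  simp only [dotProduct, Finset.sum_const, Finset.card_univ, Fintype.card_fin, nsmul_eq_mul,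
    mul_zero, sub_zero, ← Finset.mul_sum, ← pow_two]
  ring

theorem pairVec_dotProduct {n : ℕ} (i j : Fin n) (u : Fin n → ℝ) :
    pairVec n i j ⬝ᵥ u = u i - u j := by
  simp [pairVec, dotProduct, sub_mul, Finset.sum_sub_distrib]

theorem onesMat_mulVec (n : ℕ) (y : Fin n → ℝ) :
    onesMat n *ᵥ y = fun _ => (∑ i, y i) / n := by
  funext k
  simp [Matrix.mulVec, dotProduct, onesMat, ← Finset.mul_sum, div_eq_inv_mul]

theorem onesMat_transpose (n : ℕ) : (onesMat n)ᵀ = onesMat n := rfl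

theorem Lap_transpose (n m : ℕ) (A : Matrix (Fin m) (Fin n) ℝ) (w s : Fin m → ℝ) :
    (Lap n m A w s)ᵀ = Lap n m A w s := by
  simp [Lap, Matrix.transpose_mul, Matrix.mul_assoc]

theorem Lap_apply (n m : ℕ) (A : Matrix (Fin m) (Fin n) ℝ) (w s : Fin m → ℝ) (i j : Fin n) :
    Lap n m A w s i j = ∑ f, A f i * (w f * s f) * A f j := by
  rw [Lap, Matrix.mul_apply]
  simp only [Matrix.mul_diagonal, Matrix.transpose_apply]

theorem Lap_update (n m : ℕ) (A : Matrix (Fin m) (Fin n) ℝ) (w s : Fin m → ℝ) (e : Fin m)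
    (t : ℝ) :
    Lap n m A w (Function.update s e t)
      = Lap n m A w s + (t - s e) • (w e • vecMulVec (A e) (A e)) := by
  ext i j
  simp only [Lap_apply, Matrix.add_apply, Matrix.smul_apply, vecMulVec_apply, smul_eq_mul]
  rw [← Finset.add_sum_erase _ _ (Finset.mem_univ e),
    ← Finset.add_sum_erase (a := e) _ (fun f => A f i * (w f * s f) * A f j) (Finset.mem_univ e),
    Finset.sum_congr rfl fun f hf => by rw [Function.update_of_ne (Finset.ne_of_mem_erase hf)]]
  rw [Function.update_self]
  ring

theorem sum_Lap_add_onesMat_mulVec {n m : ℕ} (hn : n ≠ 0) {A : Matrix (Fin m) (Fin n) ℝ}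
    {w s : Fin m → ℝ} (hconn : kerIsOnes n (Lap n m A w s)) (y : Fin n → ℝ) :
    ∑ i, ((Lap n m A w s + onesMat n) *ᵥ y) i = ∑ i, y i := by
  have hones : Lap n m A w s *ᵥ (fun _ => 1) = 0 := (hconn _).2 ⟨1, rfl⟩
  have hL : ∑ i, (Lap n m A w s *ᵥ y) i = 0 := by
    have h : (fun _ => (1 : ℝ)) ⬝ᵥ Lap n m A w s *ᵥ y = 0 := by
      rw [dotProduct_mulVec, ← mulVec_transpose, Lap_transpose, hones, zero_dotProduct]
    simpa [dotProduct] using h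
  have hn' : (n : ℝ) ≠ 0 := Nat.cast_ne_zero.2 hn
  simp only [Matrix.add_mulVec, Pi.add_apply, Finset.sum_add_distrib, hL, onesMat_mulVec]
  simp [mul_div_cancel₀, hn']

theorem isUnit_Lap_add_onesMat {n m : ℕ} (hn : n ≠ 0) {A : Matrix (Fin m) (Fin n) ℝ}
    {w s : Fin m → ℝ} (hconn : kerIsOnes n (Lap n m A w s)) :
    IsUnit (Lap n m A w s + onesMat n) := by
  rw [← Matrix.mulVec_injective_iff_isUnit]
  refine (injective_iff_map_eq_zero (Matrix.mulVecLin (Lap n m A w s + onesMat n))).2 fun y hy => ?_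
  rw [Matrix.mulVecLin_apply] at hy
  have hsum : ∑ i, y i = 0 := by
    rw [← sum_Lap_add_onesMat_mulVec hn hconn y, hy]
    simp
  have hLy : Lap n m A w s *ᵥ y = 0 := by
    rw [Matrix.add_mulVec, onesMat_mulVec, hsum] at hy
    simpa [funext_iff] using hy
  obtain ⟨c, rfl⟩ := (hconn y).1 hLy
  have hc : c = 0 := by simpa [hn] using hsum
  funext i
  simp [hc]

theorem sum_row_of_isIncidence {n m : ℕ} {A : Matrix (Fin m) (Fin n) ℝ} (hA : isIncidence n m A)
    (e : Fin m) : ∑ i, A e i = 0 := by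
  obtain ⟨i, j, -, h⟩ := hA e
  simp [h, Finset.sum_sub_distrib]

/-- Gradient of the total effective resistance.
For a fixed edge `e` and any connected `s` with nonnegative entries, `R` is
differentiable in the coordinate `s_e` with `∂R(s)/∂s_e = −n·w_e·a_eᵀ (L_s†)² a_e`. -/
theorem totalRes_partial_derivative
    (n m : ℕ) (hn : 2 ≤ n) (hm : 1 ≤ m)
    (A : Matrix (Fin m) (Fin n) ℝ) (hA : isIncidence n m A)
    (w : Fin m → ℝ) (hw : ∀ e, 0 < w e)
    (e : Fin m) (s : Fin m → ℝ) (hs : ∀ f, 0 ≤ s f)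
    (hconn : kerIsOnes n (Lap n m A w s)) :
    HasDerivAt (fun t : ℝ => totalRes n m A w (Function.update s e t))
      (-((n : ℝ) * w e *
          (A e ⬝ᵥ (Lpinv n m A w s * Lpinv n m A w s).mulVec (A e)))) (s e) := by
  have hn0 : n ≠ 0 := by omega
  set M := Lap n m A w s + onesMat n with hM
  have hunit : IsUnit M := isUnit_Lap_add_onesMat hn0 hconn
  have hdet : IsUnit M.det := (Matrix.isUnit_iff_isUnit_det M).1 hunit
  have hMT : M⁻¹ᵀ = M⁻¹ := by
    rw [Matrix.transpose_nonsing_inv, hM, Matrix.transpose_add, Lap_transpose, onesMat_transpose]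
  set u := M⁻¹ *ᵥ A e with hu
  have hMu : M *ᵥ u = A e := by
    rw [hu, Matrix.mulVec_mulVec, Matrix.mul_nonsing_inv _ hdet, Matrix.one_mulVec]
  have hsum : ∑ i, u i = 0 := by
    rw [← sum_Lap_add_onesMat_mulVec hn0 hconn u, ← hM, hMu, sum_row_of_isIncidence hA]
  have hPinv : Lpinv n m A w s *ᵥ A e = u := by
    rw [Lpinv, ← hM, Matrix.sub_mulVec, onesMat_mulVec, sum_row_of_isIncidence hA, ← hu]
    funext i
    simp
  have hPinvT : (Lpinv n m A w s)ᵀ = Lpinv n m A w s := by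
    rw [Lpinv, ← hM, Matrix.transpose_sub, hMT, onesMat_transpose]
  have hquad : A e ⬝ᵥ (Lpinv n m A w s * Lpinv n m A w s) *ᵥ A e = u ⬝ᵥ u := by
    rw [← Matrix.mulVec_mulVec, hPinv, dotProduct_mulVec, ← mulVec_transpose, hPinvT, hPinv]
  have hentry : ∀ p : Fin n → ℝ,
      HasDerivAt (fun t : ℝ => p ⬝ᵥ Lpinv n m A w (Function.update s e t) *ᵥ p)
        (-(w e * (p ⬝ᵥ u) ^ 2)) (s e) := by
    intro p
    have hd := (hasDerivAt_dotProduct_inv_mulVec M (w e • vecMulVec (A e) (A e)) hunit (s e) p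
      p).sub_const (p ⬝ᵥ onesMat n *ᵥ p)
    have hfun : (fun t : ℝ => p ⬝ᵥ Lpinv n m A w (Function.update s e t) *ᵥ p)
        = fun t => p ⬝ᵥ (M + (t - s e) • w e • vecMulVec (A e) (A e))⁻¹ *ᵥ p
          - p ⬝ᵥ onesMat n *ᵥ p := by
      funext t
      rw [Lpinv, Lap_update, Matrix.sub_mulVec, dotProduct_sub, hM, add_right_comm]
    rw [hfun]
    refine hd.congr_deriv ?_
    have hAp : A e ⬝ᵥ M⁻¹ *ᵥ p = p ⬝ᵥ u := by
      rw [dotProduct_mulVec, ← mulVec_transpose, hMT, dotProduct_comm]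
    rw [← Matrix.mulVec_mulVec, ← Matrix.mulVec_mulVec, Matrix.smul_mulVec,
      Matrix.vecMulVec_mulVec, hAp, Matrix.mulVec_smul]
    simp only [op_smul_eq_smul, Matrix.mulVec_smul, ← hu, dotProduct_smul, smul_eq_mul]
    ring
  rw [hquad]
  have htotal : HasDerivAt (fun t : ℝ => totalRes n m A w (Function.update s e t))
      (∑ i, ∑ j, if i < j then -(w e * (u i - u j) ^ 2) else 0) (s e) := by
    unfold totalRes
    refine HasDerivAt.fun_sum fun i _ => HasDerivAt.fun_sum fun j _ => ?_
    split_ifs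
    · simpa only [pairVec_dotProduct i j u] using hentry (pairVec n i j)
    · exact hasDerivAt_const _ _
  refine htotal.congr_deriv (Eq.symm ?_)
  rw [mul_comm (n : ℝ), mul_assoc, ← sum_lt_sq_sub u hsum]
  simp only [Finset.mul_sum, ← Finset.sum_neg_distrib]
  refine Finset.sum_congr rfl fun i _ => Finset.sum_congr rfl fun j _ => ?_
  split_ifs <;> simp
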